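/- There is no computable rational-valued function f on binary strings such that |f(x) − K(x)| ≤ n/log n for all binary strings x of length n, where log denotes the binary logarithm. Equivalently, K is not computable to within additive error n/log n. -/

import Mathlib

open Filter

/-- Binary strings. -/
abbrev BStr := List Bool

/-- A prefix (Turing) machine: a partial computable map from (program, auxiliary input)
to output, whose set of halting programs is prefix-free for each auxiliary input. -/
structure PrefixMachine where
  eval : BStr → BStr →. BStr
  partrec : Partrec₂ eval
  prefixFree : ∀ y p q, (eval p y).Dom → (eval q y).Dom → p <+: q → p = q

/-- A reference universal prefix machine, together with a computable, monotone,
step-bounded evaluation function (`evaln k p y` is the result of running program `p`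
with auxiliary input `y` for `k` steps). -/
structure UniversalPrefixMachine extends PrefixMachine where
  evaln : ℕ → BStr → BStr → Option BStr
  evaln_computable : Computable fun q : (ℕ × BStr) × BStr => evaln q.1.1 q.1.2 q.2
  evaln_mono : ∀ {k k' : ℕ} {p y x : BStr}, k ≤ k' → evaln k p y = some x → evaln k' p y = some x
  eval_eq_evaln : ∀ p y x, x ∈ eval p y ↔ ∃ k, evaln k p y = some x
  universal : ∀ M : PrefixMachine, ∃ c : ℕ, ∀ p y r, r ∈ M.eval p y →
    ∃ q : BStr, q.length ≤ p.length + c ∧ r ∈ eval q y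

variable (U : UniversalPrefixMachine)

/-- Conditional prefix Kolmogorov complexity `K(x|y)`. -/
noncomputable def Kcond (x y : BStr) : ℕ :=
  sInf { n | ∃ p : BStr, p.length = n ∧ x ∈ U.eval p y }

/-- Unconditional prefix Kolmogorov complexity `K(x) = K(x|ε)`. -/
noncomputable def K (x : BStr) : ℕ := Kcond U x []

/-- Information distance `E(x,y) = max{K(x|y), K(y|x)}`. -/
noncomputable def E (x y : BStr) : ℕ := max (Kcond U x y) (Kcond U y x)

/-- Normalized information distance `e(x,y) = E(x,y) / max{K(x), K(y)}`. -/
noncomputable def nid (x y : BStr) : ℝ := (E U x y : ℝ) / (max (K U x) (K U y) : ℝ)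

/-- Time-bounded conditional complexity `K^t(x|y)`: the time bound is measured
in terms of the length of the output `x`. -/
noncomputable def KcondT (t : ℕ → ℕ) (x y : BStr) : ℕ :=
  sInf { n | ∃ p : BStr, p.length = n ∧ U.evaln (t x.length) p y = some x }

/-- Time-bounded information distance `E^t(x,y)`. -/
noncomputable def Et (t : ℕ → ℕ) (x y : BStr) : ℕ := max (KcondT U t x y) (KcondT U t y x)

/-- A real-valued function on pairs of strings is upper semicomputable if it is the limit of a
computable, nonincreasing (in the extra parameter) sequence of rational approximations. -/
def UpperSemicomputable₂ (f : BStr → BStr → ℝ) : Prop :=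
  ∃ φ : BStr × BStr → ℕ → ℚ, Computable₂ φ ∧
    (∀ p, Antitone (φ p)) ∧
    ∀ p : BStr × BStr, Tendsto (fun k => ((φ p k : ℚ) : ℝ)) atTop (nhds (f p.1 p.2))

/-- A real-valued function is lower semicomputable if its negation is upper semicomputable. -/
def LowerSemicomputable₂ (f : BStr → BStr → ℝ) : Prop :=
  UpperSemicomputable₂ fun x y => -f x y

/-- Upper semicomputability for functions of one string argument. -/
def UpperSemicomputable (f : BStr → ℝ) : Prop :=
  ∃ φ : BStr → ℕ → ℚ, Computable₂ φ ∧
    (∀ x, Antitone (φ x)) ∧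
    ∀ x, Tendsto (fun k => ((φ x k : ℚ) : ℝ)) atTop (nhds (f x))

theorem computable_ofNat_subtype (s : Set ℕ) [DecidablePred (· ∈ s)] [Infinite s]
    (hs : ComputablePred (fun n => n ∈ s)) :
    Computable (fun n => (Nat.Subtype.ofNat s n : ℕ)) := by
  have hex : ∀ x : ℕ, ∃ m, x + m + 1 ∈ s := by
    intro x
    obtain ⟨y, hy, hxy⟩ := (Set.infinite_coe_iff.1 ‹Infinite s›).exists_gt x
    exact ⟨y - x - 1, by rwa [show x + (y - x - 1) + 1 = y by omega]⟩
  have hfind : Computable (fun x : ℕ => Nat.find (hex x)) := by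
    refine Computable.find (P := fun x m => x + m + 1 ∈ s) ?_ hex
    refine Computable.computablePred ?_
    exact hs.decide.comp (Primrec.succ.comp (Primrec.nat_add.comp Primrec.fst Primrec.snd)).to_comp
  have hnext : Computable (fun x : ℕ => x + Nat.find (hex x) + 1) :=
    Computable.succ.comp (Primrec.nat_add.to_comp.comp Computable.id hfind)
  refine (Computable.nat_rec (f := fun n : ℕ => n)
    (g := fun _ => ((Nat.Subtype.ofNat s 0 : s) : ℕ))
    (h := fun _ p => p.2 + Nat.find (hex p.2) + 1) Computable.id (Computable.const _)
    (hnext.comp (Computable.snd.comp Computable.snd)).to₂).of_eq ?_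
  intro n
  induction n with
  | zero => rfl
  | succ n ih =>
    simp only at ih ⊢
    rw [ih]
    rfl

/-- code of a rational before re-ranking -/
def ratCode (q : ℚ) : ℕ := Nat.pair (Equiv.intEquivNat q.num) q.den

theorem encode_old (q : ℚ) : @Encodable.encode ℚ Rat.instEncodable q = ratCode q := by
  cases q; rfl

def codePred (a d : ℕ) : Prop :=
  0 < d ∧ ∀ x < d + 1, x ∣ a → x ∣ d → x = 1

theorem codePred_iff (a d : ℕ) : codePred a d ↔ 0 < d ∧ a.Coprime d := by
  unfold codePred
  constructor
  · rintro ⟨h, h2⟩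
    refine ⟨h, h2 (a.gcd d) ?_ (Nat.gcd_dvd_left _ _) (Nat.gcd_dvd_right _ _)⟩
    exact Nat.lt_succ_of_le (Nat.gcd_le_right _ h)
  · rintro ⟨h, h2⟩
    exact ⟨h, fun x _ hx hy => Nat.eq_one_of_dvd_coprimes h2 hx hy⟩

theorem codePred_primrec : PrimrecRel codePred := by
  have h1 : PrimrecRel (fun (x : ℕ) (y : ℕ × ℕ) => ¬ (y.1 % x = 0 ∧ y.2 % x = 0 ∧ ¬ x = 1)) := by
    have hx : Primrec (fun p : ℕ × (ℕ × ℕ) => p.1) := Primrec.fst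
    have ha : Primrec (fun p : ℕ × (ℕ × ℕ) => p.2.1) := Primrec.fst.comp Primrec.snd
    have hd : Primrec (fun p : ℕ × (ℕ × ℕ) => p.2.2) := Primrec.snd.comp Primrec.snd
    have e1 := Primrec.eq.comp (Primrec.nat_mod.comp ha hx) (Primrec.const 0)
    have e2 := Primrec.eq.comp (Primrec.nat_mod.comp hd hx) (Primrec.const 0)
    have e3 := Primrec.eq.comp hx (Primrec.const 1)
    exact (e1.and (e2.and e3.not)).not
  have h2 := PrimrecRel.forall_mem_list h1
  have h3 : PrimrecPred (fun p : ℕ × ℕ => ∀ x < p.2 + 1, ¬ (p.1 % x = 0 ∧ p.2 % x = 0 ∧ ¬ x = 1)) :=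
    (PrimrecRel.comp h2 (Primrec.list_range.comp (Primrec.succ.comp Primrec.snd)) Primrec.id).of_eq
      (fun p => by simp only [List.mem_range, id, Nat.succ_eq_add_one])
  have h4 : PrimrecPred (fun p : ℕ × ℕ => 0 < p.2) :=
    Primrec.nat_lt.comp (Primrec.const 0) Primrec.snd
  refine (h4.and h3).of_eq ?_
  intro p
  simp only [codePred, Nat.dvd_iff_mod_eq_zero]
  grind

theorem mem_range_iff (n : ℕ) : n ∈ Set.range (@Encodable.encode ℚ Rat.instEncodable) ↔
    codePred (n.unpair.1.div2 + (n.unpair.1.bodd).toNat) n.unpair.2 := by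
  have key : ∀ z : ℤ, (Equiv.intEquivNat z).div2 + (Equiv.intEquivNat z).bodd.toNat = z.natAbs := by
    intro z
    rcases z with z | z
    · have : Equiv.intEquivNat (Int.ofNat z) = 2 * z := rfl
      rw [this]; simp [Nat.div2_val]
    · have : Equiv.intEquivNat (Int.negSucc z) = 2 * z + 1 := rfl
      rw [this]; simp [Nat.div2_val]
  rw [codePred_iff]
  constructor
  · rintro ⟨q, rfl⟩
    rw [encode_old, ratCode, Nat.unpair_pair]
    simp only
    rw [key]
    exact ⟨q.pos, q.reduced⟩
  · rintro ⟨h1, h2⟩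
    have k := key (Equiv.intEquivNat.symm n.unpair.1)
    rw [Equiv.apply_symm_apply] at k
    rw [k] at h2
    refine ⟨⟨Equiv.intEquivNat.symm n.unpair.1, n.unpair.2, h1.ne', h2⟩, ?_⟩
    rw [encode_old, ratCode]
    simp

theorem ratCode_computable : Computable ratCode := by
  let := @Encodable.decidableRangeEncode ℚ Rat.instEncodable
  have : Infinite (Set.range (@Encodable.encode ℚ Rat.instEncodable)) :=
    Infinite.of_injective _ (Equiv.ofInjective _ (@Encodable.encode_injective ℚ Rat.instEncodable)).injective
  have hs : ComputablePred (fun n => n ∈ Set.range (@Encodable.encode ℚ Rat.instEncodable)) := by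
    have hu : Primrec (fun n : ℕ => n.unpair.1) := Primrec.fst.comp Primrec.unpair
    have hb : Primrec (fun n : ℕ => (n.unpair.1.bodd).toNat) :=
      (Primrec.cond (Primrec.nat_bodd.comp hu) (Primrec.const 1) (Primrec.const 0)).of_eq
        (fun n => by cases n.unpair.1.bodd <;> rfl)
    have := PrimrecRel.comp codePred_primrec
      (Primrec.nat_add.comp (Primrec.nat_div2.comp hu) hb) (Primrec.snd.comp Primrec.unpair)
    exact (this.of_eq (fun n => (mem_range_iff n).symm)).computablePred
  have h := computable_ofNat_subtype _ hs
  refine (h.comp (Computable.encode (α := ℚ))).of_eq ?_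
  intro q
  let := Nat.Subtype.denumerable (Set.range (@Encodable.encode ℚ Rat.instEncodable))
  have h1 : Denumerable.ofNat ℚ (@Encodable.encode ℚ Rat.instDenumerable.toEncodable q) = q := Denumerable.ofNat_encode q
  have h2 : Denumerable.ofNat ℚ (@Encodable.encode ℚ Rat.instDenumerable.toEncodable q) =
      (@Encodable.equivRangeEncode ℚ Rat.instEncodable).symm (Denumerable.ofNat _ (@Encodable.encode ℚ Rat.instDenumerable.toEncodable q)) :=
    Denumerable.ofEquiv_ofNat _ _ _
  rw [h1, Equiv.eq_symm_apply] at h2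
  rw [← encode_old]
  exact (congrArg Subtype.val h2).symm

theorem rat_le_computable : Computable (fun p : ℚ × ℕ => decide ((p.2 : ℚ) ≤ p.1)) := by
  have hc : Primrec (fun p : ℕ × ℕ =>
      (!p.1.unpair.1.bodd) && decide (p.2 * p.1.unpair.2 ≤ p.1.unpair.1.div2)) := by
    have hu : Primrec (fun p : ℕ × ℕ => p.1.unpair) := Primrec.unpair.comp Primrec.fst
    have hl : PrimrecPred (fun p : ℕ × ℕ => p.2 * p.1.unpair.2 ≤ p.1.unpair.1.div2) :=
      Primrec.nat_le.comp (Primrec.nat_mul.comp Primrec.snd (Primrec.snd.comp hu))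
      (Primrec.nat_div2.comp (Primrec.fst.comp hu))
    exact Primrec.and.comp
      (Primrec.not.comp (Primrec.nat_bodd.comp (Primrec.fst.comp hu))) hl.decide
  refine (hc.to_comp.comp ((ratCode_computable.comp Computable.fst).pair Computable.snd)).of_eq ?_
  rintro ⟨q, m⟩
  have hq : ((m : ℚ) ≤ q) ↔ ((m : ℤ) * q.den ≤ q.num) := by
    rw [Rat.le_iff]; simp
  simp only [hq, ratCode, Nat.unpair_pair]
  rcases q.num with z | z
  · have : Equiv.intEquivNat (Int.ofNat z) = 2 * z := rfl
    rw [this]; simp [Nat.div2_val]; norm_cast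
  · have : Equiv.intEquivNat (Int.negSucc z) = 2 * z + 1 := rfl
    rw [this]; simp [Nat.div2_val]
    have : (0:ℤ) ≤ m * q.den := by positivity
    omega

theorem rat_le_computable₂ {α : Type*} [Primcodable α] {f : α → ℚ} {g : α → ℕ}
    (hf : Computable f) (hg : Computable g) :
    Computable (fun a => decide ((g a : ℚ) ≤ f a)) := by
  have h : ∃ F : ℚ × ℕ → Bool, Computable F ∧ ∀ p, F p = decide ((p.2 : ℚ) ≤ p.1) :=
    ⟨_, rat_le_computable, fun _ => rfl⟩
  obtain ⟨F, hF, hFe⟩ := h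
  refine (hF.comp (hf.pair hg)).of_eq ?_
  intro a
  rw [hFe]

/-- unary-coded prefix machine -/
def unaryMachine (g : ℕ →. BStr) (hg : Partrec g) : PrefixMachine where
  eval p _ := bif decide (p.idxOf false + 1 = p.length) then g p.length else Part.none
  partrec := by
    have hp : Primrec (fun q : BStr × BStr => q.1) := Primrec.fst
    have hi : Primrec (fun q : BStr × BStr => q.1.idxOf false + 1) :=
      Primrec.succ.comp (Primrec.list_idxOf.comp (Primrec.const false) hp)
    have hl : Primrec (fun q : BStr × BStr => q.1.length) := Primrec.list_length.comp hp
    have hc : PrimrecPred (fun q : BStr × BStr => q.1.idxOf false + 1 = q.1.length) :=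
      Primrec.eq.comp hi hl
    exact Partrec.cond hc.decide.to_comp (hg.comp hl.to_comp) Partrec.none
  prefixFree := by
    intro y p q hp hq hpq
    have hp' : p.idxOf false + 1 = p.length := by
      by_contra h; simp [h] at hp
    have hq' : q.idxOf false + 1 = q.length := by
      by_contra h; simp [h] at hq
    refine hpq.eq_of_length ?_
    obtain ⟨t, rfl⟩ := hpq
    have hm : false ∈ p := List.idxOf_lt_length_iff.1 (by omega)
    rw [List.idxOf_append_of_mem hm] at hq'
    omega

theorem unaryMachine_eval (g : ℕ →. BStr) (hg : Partrec g) (k : ℕ) (y : BStr) :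
    (unaryMachine g hg).eval (List.replicate k true ++ [false]) y = g (k + 1) := by
  have : (List.replicate k true ++ [false]).idxOf false = k := by
    rw [List.idxOf_append_of_notMem (by simp)]; simp
  simp only [unaryMachine, this]
  simp

theorem K_unary_le (U : UniversalPrefixMachine) (g : ℕ →. BStr) (hg : Partrec g) :
    ∃ c : ℕ, ∀ k x, x ∈ g (k + 1) → K U x ≤ k + 1 + c := by
  obtain ⟨c, hc⟩ := U.universal (unaryMachine g hg)
  refine ⟨c, fun k x hx => ?_⟩
  obtain ⟨q, hq, hxq⟩ := hc (List.replicate k true ++ [false]) [] x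
    (by rwa [unaryMachine_eval])
  have : K U x ≤ q.length := Nat.sInf_le ⟨q, rfl, hxq⟩
  simp at hq
  omega

theorem K_program (U : UniversalPrefixMachine) (x : BStr) :
    ∃ p : BStr, p.length = K U x ∧ x ∈ U.eval p [] := by
  have hne : { n | ∃ p : BStr, p.length = n ∧ x ∈ U.eval p [] }.Nonempty := by
    obtain ⟨c, hc⟩ := U.universal (unaryMachine (fun _ => Part.some x) (Computable.const x))
    obtain ⟨q, -, hxq⟩ := hc (List.replicate 0 true ++ [false]) [] x
      ((Part.ext_iff.1 (unaryMachine_eval (fun _ => Part.some x) (Computable.const x) 0 []) x).2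
        (Part.mem_some x))
    exact ⟨_, q, rfl, hxq⟩
  exact Nat.sInf_mem hne

theorem exists_incompressible (U : UniversalPrefixMachine) (n : ℕ) :
    ∃ x : BStr, x.length = n ∧ n ≤ K U x := by
  by_contra hcon
  push Not at hcon
  choose prog hlen hmem using K_program U
  let F : List.Vector Bool n → (Σ i : Fin n, List.Vector Bool i) := fun v =>
    ⟨⟨K U v.1, hcon v.1 v.2⟩, ⟨prog v.1, hlen v.1⟩⟩
  have hF : Function.Injective F := by
    intro v w h
    have h2 : ∀ a b : (Σ i : Fin n, List.Vector Bool i), a = b → a.2.1 = b.2.1 := by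
      rintro a b rfl; rfl
    have h3 : prog v.1 = prog w.1 := h2 _ _ h
    have hv := hmem v.1
    rw [h3] at hv
    exact Subtype.ext (Part.mem_unique hv (hmem w.1))
  have hcard := Fintype.card_le_of_injective F hF
  simp only [Fintype.card_sigma, card_vector, Fintype.card_bool] at hcard
  rw [Fin.sum_univ_eq_sum_range (fun i => 2 ^ i) n] at hcard
  have := Nat.geomSum_lt (m := 2) (n := n) (s := Finset.range n) le_rfl (by simp)
  omega

/-- `K` is not computable to within additive error `n / log n`: there is no computable
rational-valued function `f` on binary strings such that `|f(x) - K(x)| ≤ n / log n`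
for all binary strings `x` of length `n` (`log` is the binary logarithm). -/
theorem K_not_computable_within_error (U : UniversalPrefixMachine) :
    ¬ ∃ f : BStr → ℚ, Computable f ∧
      ∀ x : BStr, |(f x : ℝ) - (K U x : ℝ)| ≤ (x.length : ℝ) / Real.logb 2 x.length := by
  rintro ⟨f, hf, hK⟩
  let T : ℕ → BStr → Bool := fun n x => decide (x.length = 16 * n) && decide (((8 * n : ℕ) : ℚ) ≤ f x)
  have hT : Computable₂ T := by
    have h1 : PrimrecPred (fun p : ℕ × BStr => p.2.length = 16 * p.1) :=
      Primrec.eq.comp (Primrec.list_length.comp Primrec.snd)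
        (Primrec.nat_mul.comp (Primrec.const 16) Primrec.fst)
    have hm : Computable (fun p : ℕ × BStr => 8 * p.1) :=
      (Primrec.nat_mul.comp (Primrec.const 8) Primrec.fst).to_comp
    have h2 : Computable (fun p : ℕ × BStr => decide (((8 * p.1 : ℕ) : ℚ) ≤ f p.2)) :=
      rat_le_computable₂ (hf.comp Computable.snd) hm
    exact Primrec.and.to_comp.comp h1.decide.to_comp h2
  let s : ℕ → ℕ → Option BStr := fun n i =>
    (Encodable.decode i : Option BStr).bind fun x => bif T n x then some x else none
  have hs : Computable₂ s := by
    refine Computable.option_bind (Computable.decode.comp Computable.snd) ?_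
    have hx : Computable (fun p : (ℕ × ℕ) × BStr => p.2) := Computable.snd
    exact Computable.cond (hT.comp (Computable.fst.comp Computable.fst) hx)
      (Computable.option_some.comp hx) (Computable.const none)
  have hg := Partrec.rfindOpt hs
  obtain ⟨c, hc⟩ := K_unary_le U _ hg
  have herr : ∀ x : BStr, x.length = 16 * (c + 1) →
      |(f x : ℝ) - (K U x : ℝ)| ≤ 4 * (c + 1) := by
    intro x hx
    refine (hK x).trans ?_
    have hl : (4 : ℝ) ≤ Real.logb 2 x.length := by
      rw [Real.le_logb_iff_rpow_le (by norm_num) (by rw [hx]; positivity), hx]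
      push_cast
      have : (0 : ℝ) ≤ c := by positivity
      norm_num
    have hx' : (x.length : ℝ) = 16 * (c + 1) := by rw [hx]; push_cast; ring
    rw [div_le_iff₀ (by linarith)]
    generalize Real.logb 2 x.length = l at hl
    rw [hx']
    nlinarith [show (0 : ℝ) ≤ c by positivity]
  obtain ⟨x₀, hx₀, hKx₀⟩ := exists_incompressible U (16 * (c + 1))
  have hdom : (Nat.rfindOpt (s (c + 1))).Dom := by
    refine Nat.rfindOpt_dom.2 ⟨Encodable.encode x₀, x₀, ?_⟩
    have h := abs_le.1 (herr x₀ hx₀)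
    have h1 : ((16 * (c + 1) : ℕ) : ℝ) ≤ K U x₀ := by exact_mod_cast hKx₀
    have h2 : ((8 * (c + 1) : ℕ) : ℚ) ≤ f x₀ := by
      have : ((8 * (c + 1) : ℕ) : ℝ) ≤ f x₀ := by
        push_cast at h1 ⊢
        linarith [show (0 : ℝ) ≤ c by positivity]
      exact_mod_cast this
    have h3 : T (c + 1) x₀ = true := by
      simp only [T, Bool.and_eq_true, decide_eq_true_eq]
      exact ⟨hx₀, h2⟩
    simp [s, h3]
  obtain ⟨x, hx⟩ := Part.dom_iff_mem.1 hdom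
  have hle := hc c x hx
  obtain ⟨i, hi⟩ := Nat.rfindOpt_spec hx
  have hTx : T (c + 1) x = true := by
    simp only [s, Option.mem_def, Option.bind_eq_some_iff] at hi
    obtain ⟨z, -, hz⟩ := hi
    cases hb : T (c + 1) z with
    | false => simp [hb] at hz
    | true => simp [hb] at hz; rwa [← hz]
  simp only [T, Bool.and_eq_true, decide_eq_true_eq] at hTx
  have h := abs_le.1 (herr x hTx.1)
  have h2 : ((8 * (c + 1) : ℕ) : ℝ) ≤ f x := by exact_mod_cast hTx.2
  have h3 : (K U x : ℝ) ≤ ((c + 1 + c : ℕ) : ℝ) := by exact_mod_cast hle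
  push_cast at h2 h3
  linarith [show (0 : ℝ) ≤ c by positivity]
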